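/- arXiv:2506.07158 — 6 statements merged into one kernel-verified Lean document; each statement's English description precedes it below -/
import Mathlib

section
/- Let E be a finite set with N := |E| and let f : {0,1}^E → ℝ. For p ∈ ℝ define E_p[f] := ∑_{a ∈ {0,1}^E} p^{#{e : a(e)=1}} (1−p)^{#{e : a(e)=0}} f(a). Then p ↦ E_p[f] is a polynomial function on ℝ, and for every k ∈ ℕ and every p ∈ (0,1) its k-th derivative satisfies (d/dp)^k E_p[f] = (k! / (1−p)^k) · ∑_{F ⊆ E, |F| = k} E_p[D_F f]. (This is the paper's Proposition 3.1, applied there to f = ℰ_{m,ξ}, giving the derivatives of the finite-volume conductivity ā_m(p).) -/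
noncomputable section

open Finset

variable {E : Type*} [DecidableEq E]

/-- The configuration obtained from `a` by opening all the bonds in `G` (`a^G` in the paper). -/
def opn (a : E → Bool) (G : Finset E) : E → Bool := fun e => if e ∈ G then true else a e

/-- The Glauber derivative with respect to a single bond: `(D_e f)(a) = f(a^e) − f(a)`. -/
def D1 {β : Type*} [AddCommGroup β] (e : E) (f : (E → Bool) → β) : (E → Bool) → β :=
  fun a => f (opn a {e}) - f a

/-- The iterated Glauber derivative `D_G = D_{e₁} ∘ ⋯ ∘ D_{eₙ}` for `G = {e₁, …, eₙ}`
(well defined independently of the order since the operators `D_e` commute); `D_∅ f = f`. -/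
def DG {β : Type*} [AddCommGroup β] (G : Finset E) (f : (E → Bool) → β) : (E → Bool) → β :=
  G.toList.foldr D1 f

/-- `E_p[f] = ∑_{a ∈ {0,1}^E} p^{#{e : a(e)=1}} (1−p)^{#{e : a(e)=0}} f(a)`. -/
def expVal {E : Type*} [Fintype E] [DecidableEq E] (f : (E → Bool) → ℝ) (p : ℝ) : ℝ :=
  ∑ a : E → Bool,
    p ^ (Finset.univ.filter fun e => a e = true).card *
      (1 - p) ^ (Finset.univ.filter fun e => a e = false).card * f a

lemma aux_opn_comm (a : E → Bool) (x y : E) :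
    opn (opn a {x}) {y} = opn (opn a {y}) {x} := by
  funext e
  simp only [opn]
  split_ifs <;> rfl

lemma aux_D1_comm (x y : E) (f : (E → Bool) → ℝ) : D1 x (D1 y f) = D1 y (D1 x f) := by
  funext a
  simp only [D1]
  rw [aux_opn_comm a x y]
  ring

lemma aux_D1_self (x : E) (f : (E → Bool) → ℝ) : D1 x (D1 x f) = -D1 x f := by
  funext a
  have h : opn (opn a {x}) {x} = opn a {x} := by
    funext e
    simp only [opn]
    split_ifs <;> rfl
  simp only [D1, h, Pi.neg_apply]
  ring

lemma aux_DG_insert (e : E) (F : Finset E) (h : e ∉ F) (f : (E → Bool) → ℝ) :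
    DG (insert e F) f = D1 e (DG F f) := by
  haveI : LeftCommutative (D1 : E → ((E → Bool) → ℝ) → ((E → Bool) → ℝ)) :=
    ⟨fun x y g => aux_D1_comm x y g⟩
  unfold DG
  rw [(Finset.toList_insert h).foldr_eq f]
  rfl

lemma aux_DG_mem (e : E) (F : Finset E) (h : e ∈ F) (f : (E → Bool) → ℝ) :
    D1 e (DG F f) = -DG F f := by
  rw [← Finset.insert_erase h, aux_DG_insert e _ (Finset.notMem_erase e F), aux_D1_self]

lemma aux_expVal_eq {E : Type*} [Fintype E] [DecidableEq E] (f : (E → Bool) → ℝ) (p : ℝ) :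
    expVal f p = ∑ a : E → Bool, (∏ e, if a e = true then p else 1 - p) * f a := by
  unfold expVal
  refine Finset.sum_congr rfl fun a _ => ?_
  rw [Finset.prod_ite, Finset.prod_const, Finset.prod_const]
  simp

lemma aux_expVal_neg {E : Type*} [Fintype E] [DecidableEq E] (f : (E → Bool) → ℝ) (p : ℝ) :
    expVal (-f) p = -expVal f p := by
  simp [expVal]

lemma aux_cancel {E : Type*} [Fintype E] [DecidableEq E] (f : (E → Bool) → ℝ) (p : ℝ) (e : E) :
    (1 - p) * ∑ a : E → Bool, (∏ x ∈ univ.erase e, if a x = true then p else 1 - p) *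
      (if a e = true then 1 else -1) * f a = expVal (D1 e f) p := by
  rw [aux_expVal_eq, Finset.mul_sum, ← sub_eq_zero, ← Finset.sum_sub_distrib]
  refine Finset.sum_involution (fun a _ => Function.update a e (!a e)) ?_ ?_ ?_ ?_
  · intro a _
    have h1 : ∀ b : E → Bool, (∏ x, if b x = true then p else 1 - p) =
        (if b e = true then p else 1 - p) * ∏ x ∈ univ.erase e, if b x = true then p else 1 - p :=
      fun b => (Finset.mul_prod_erase univ _ (Finset.mem_univ e)).symm
    have h2 : (∏ x ∈ univ.erase e,
        if Function.update a e (!a e) x = true then p else 1 - p) =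
        ∏ x ∈ univ.erase e, if a x = true then p else 1 - p := by
      refine Finset.prod_congr rfl fun x hx => ?_
      rw [Function.update_of_ne (Finset.ne_of_mem_erase hx)]
    rw [h1, h1, h2]
    have h3 : opn (Function.update a e (!a e)) {e} = opn a {e} := by
      funext x
      by_cases hx : x = e <;> simp [opn, hx]
    simp only [D1, h3, Function.update_self]
    cases h : a e
    · have h4 : Function.update a e (!false) = opn a {e} := by
        funext x
        by_cases hx : x = e <;> simp [opn, hx, Function.update]
      rw [h4]
      simp
      ring
    · have h4 : opn a {e} = a := by
        funext x
        by_cases hx : x = e <;> simp [opn, hx, h]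
      rw [h4]
      simp
      ring
  · intro a _ _ h
    have := congrFun h e
    simp at this
  · intro a _
    exact Finset.mem_univ _
  · intro a _
    simp

lemma aux_hasDerivAt {E : Type*} [Fintype E] [DecidableEq E] (f : (E → Bool) → ℝ) (p : ℝ)
    (hp : 1 - p ≠ 0) :
    HasDerivAt (expVal f) ((1 - p)⁻¹ * ∑ e, expVal (D1 e f) p) p := by
  have h0 : expVal f = fun p => ∑ a : E → Bool, (∏ e, if a e = true then p else 1 - p) * f a :=
    funext (aux_expVal_eq f)
  have h1 : HasDerivAt (expVal f) (∑ a : E → Bool, (∑ e,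
      (∏ x ∈ univ.erase e, if a x = true then p else 1 - p) •
        (if a e = true then (1 : ℝ) else -1)) * f a) p := by
    rw [h0]
    refine HasDerivAt.fun_sum fun a _ => HasDerivAt.mul_const ?_ _
    refine HasDerivAt.fun_finsetProd fun e _ => ?_
    cases a e
    · simpa using (hasDerivAt_id p).const_sub 1
    · simpa using hasDerivAt_id' p
  convert h1 using 1
  simp_rw [← aux_cancel, ← Finset.mul_sum]
  rw [inv_mul_cancel_left₀ hp, Finset.sum_comm]
  simp only [Finset.sum_mul, smul_eq_mul]

lemma aux_count {E : Type*} [Fintype E] [DecidableEq E] (g : Finset E → ℝ) (k : ℕ) :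
    ∑ F ∈ (univ : Finset E).powersetCard k, ∑ e ∈ Fᶜ, g (insert e F) =
      (k + 1 : ℝ) * ∑ F ∈ (univ : Finset E).powersetCard (k + 1), g F := by
  have h : (k + 1 : ℝ) * ∑ F ∈ (univ : Finset E).powersetCard (k + 1), g F =
      ∑ F ∈ (univ : Finset E).powersetCard (k + 1), ∑ _e ∈ F, g F := by
    rw [Finset.mul_sum]
    refine Finset.sum_congr rfl fun F hF => ?_
    rw [Finset.sum_const, (Finset.mem_powersetCard.1 hF).2]
    simp
  rw [h, Finset.sum_sigma', Finset.sum_sigma']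
  refine Finset.sum_bij' (fun x _ => ⟨insert x.2 x.1, x.2⟩) (fun x _ => ⟨x.1.erase x.2, x.2⟩)
    ?_ ?_ ?_ ?_ ?_
  · rintro ⟨F, e⟩ h
    simp only [mem_sigma, mem_powersetCard, subset_univ, true_and, mem_compl] at h ⊢
    simp [Finset.card_insert_of_notMem h.2, h.1]
  · rintro ⟨F, e⟩ h
    simp only [mem_sigma, mem_powersetCard, subset_univ, true_and, mem_compl] at h ⊢
    simp [Finset.card_erase_of_mem h.2, h.1]
  · rintro ⟨F, e⟩ h
    simp only [mem_sigma, mem_powersetCard, subset_univ, true_and, mem_compl] at h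
    simp [Finset.erase_insert h.2]
  · rintro ⟨F, e⟩ h
    simp only [mem_sigma, mem_powersetCard, subset_univ, true_and] at h
    simp [Finset.insert_erase h.2]
  · rintro ⟨F, e⟩ h
    rfl

lemma aux_step {E : Type*} [Fintype E] [DecidableEq E] (f : (E → Bool) → ℝ) (p : ℝ) (k : ℕ) :
    ∑ F ∈ (univ : Finset E).powersetCard k, ∑ e, expVal (D1 e (DG F f)) p =
      (k + 1 : ℝ) * ∑ F ∈ (univ : Finset E).powersetCard (k + 1), expVal (DG F f) p
      - k * ∑ F ∈ (univ : Finset E).powersetCard k, expVal (DG F f) p := by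
  rw [← aux_count (fun F => expVal (DG F f) p), Finset.mul_sum, ← Finset.sum_sub_distrib]
  refine Finset.sum_congr rfl fun F hF => ?_
  rw [← Finset.sum_add_sum_compl F, add_comm, sub_eq_add_neg]
  congr 1
  · refine Finset.sum_congr rfl fun e he => ?_
    rw [aux_DG_insert e F (Finset.mem_compl.1 he)]
  · rw [Finset.sum_congr rfl fun e he => by rw [aux_DG_mem e F he, aux_expVal_neg],
      Finset.sum_const, (Finset.mem_powersetCard.1 hF).2]
    simp

lemma aux_main {E : Type*} [Fintype E] [DecidableEq E] (f : (E → Bool) → ℝ) (k : ℕ) :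
    ∀ p : ℝ, p < 1 → iteratedDeriv k (expVal f) p
          = (k.factorial : ℝ) / (1 - p) ^ k *
              ∑ F ∈ (Finset.univ : Finset E).powersetCard k, expVal (DG F f) p := by
  induction k with
  | zero => intro p _; simp [DG]
  | succ k ih =>
    intro p hp
    have hne : 1 - p ≠ 0 := by linarith
    rw [iteratedDeriv_succ]
    have hev : iteratedDeriv k (expVal f) =ᶠ[nhds p] fun p => (k.factorial : ℝ) / (1 - p) ^ k *
        ∑ F ∈ (Finset.univ : Finset E).powersetCard k, expVal (DG F f) p := by
      filter_upwards [Iio_mem_nhds hp] with q hq using ih q hq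
    rw [hev.deriv_eq]
    have hS : HasDerivAt (fun p => ∑ F ∈ (Finset.univ : Finset E).powersetCard k,
        expVal (DG F f) p) _ p :=
      HasDerivAt.fun_sum fun F _ => aux_hasDerivAt (DG F f) p hne
    have hc := (((hasDerivAt_id p).const_sub 1).fun_pow k).fun_inv (pow_ne_zero k hne)
    have hd := ((hc.const_mul (k.factorial : ℝ)).mul hS).deriv
    simp only [id, ← Finset.mul_sum, aux_step] at hd
    simp only [div_eq_mul_inv]
    refine hd.trans ?_
    rw [Nat.factorial_succ]
    push_cast
    rcases k with _ | k
    · simp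
    · simp only [Nat.add_sub_cancel]
      field_simp
      push_cast
      ring

/-- Proposition 3.1 of the paper.  The map `p ↦ E_p[f]` is a polynomial
function on `ℝ`, and for every `k ∈ ℕ` and `p ∈ (0,1)` its `k`-th derivative satisfies
`(d/dp)^k E_p[f] = (k!/(1−p)^k) ∑_{F ⊆ E, |F| = k} E_p[D_F f]`. -/
theorem deriv_expVal_eq_glauber_sum {E : Type*} [Fintype E] [DecidableEq E]
    (f : (E → Bool) → ℝ) :
    (∃ P : Polynomial ℝ, ∀ p : ℝ, expVal f p = P.eval p) ∧
      ∀ (k : ℕ) (p : ℝ), p ∈ Set.Ioo (0 : ℝ) 1 →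
        iteratedDeriv k (expVal f) p
          = (k.factorial : ℝ) / (1 - p) ^ k *
              ∑ F ∈ (Finset.univ : Finset E).powersetCard k, expVal (DG F f) p := by
  refine ⟨⟨∑ a : E → Bool,
    Polynomial.X ^ (Finset.univ.filter fun e => a e = true).card *
      (1 - Polynomial.X) ^ (Finset.univ.filter fun e => a e = false).card *
        Polynomial.C (f a), fun p => ?_⟩, fun k p hp => aux_main f k p hp.2⟩
  simp [expVal, Polynomial.eval_finsetSum]
end
end

section
/- Second Leibniz formula for the Glauber derivative: for every finite set E, all functions f, g : {0,1}^E → ℝ, every subset G ⊆ E, and every configuration a ∈ {0,1}^E, one has (D_G (f·g))(a) = ∑ (D_{G₁} f)(a) · (D_{G₂} g)(a), where the sum runs over all ordered pairs of subsets G₁, G₂ ⊆ G with G₁ ∪ G₂ = G, and f·g denotes the pointwise product. -/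
noncomputable section

open Finset

variable {E : Type*} [DecidableEq E]

theorem D1_comm_aux {E : Type*} [DecidableEq E] {β : Type*} [AddCommGroup β]
    (x y : E) (f : (E → Bool) → β) : D1 x (D1 y f) = D1 y (D1 x f) := by
  funext a
  have h : opn (opn a {x}) {y} = opn (opn a {y}) {x} := by
    funext z
    simp only [opn]
    split_ifs <;> rfl
  simp only [D1, h]
  abel

theorem foldr_D1_aux {E : Type*} [DecidableEq E] {β : Type*} [AddCommGroup β]
    (l : List E) (e : E) (f : (E → Bool) → β) :
    D1 e (l.foldr D1 f) = l.foldr D1 (D1 e f) := by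
  induction l with
  | nil => rfl
  | cons x l ih => rw [List.foldr_cons, List.foldr_cons, D1_comm_aux, ih]

theorem DG_insert_aux {E : Type*} [DecidableEq E] {β : Type*} [AddCommGroup β]
    (G : Finset E) (e : E) (he : e ∉ G) (f : (E → Bool) → β) :
    DG (insert e G) f = DG G (D1 e f) := by
  haveI : LeftCommutative (D1 (E := E) (β := β)) := ⟨D1_comm_aux⟩
  unfold DG
  rw [(Finset.toList_insert he).foldr_eq, List.foldr_cons, foldr_D1_aux]

theorem DG_add_aux {E : Type*} [DecidableEq E] {β : Type*} [AddCommGroup β]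
    (G : Finset E) (f g : (E → Bool) → β) :
    DG G (f + g) = DG G f + DG G g := by
  unfold DG
  induction G.toList with
  | nil => rfl
  | cons x l ih =>
    simp only [List.foldr_cons, ih]
    funext a
    simp only [D1, Pi.add_apply]
    abel

theorem leibniz_aux {E : Type*} [DecidableEq E] (G : Finset E) :
    ∀ (f g : (E → Bool) → ℝ) (a : E → Bool),
    DG G (fun b => f b * g b) a
      = ∑ s ∈ G.powerset, ∑ t ∈ G.powerset,
          if s ∪ t = G then DG s f a * DG t g a else 0 := by
  induction G using Finset.induction_on with
  | empty => intro f g a; simp [DG]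
  | insert e G he ih =>
    intro f g a
    have hD : D1 e (fun b => f b * g b) = (fun b => D1 e f b * g b)
        + (fun b => f b * D1 e g b) + (fun b => D1 e f b * D1 e g b) := by
      funext b
      simp only [D1, Pi.add_apply]
      ring
    rw [DG_insert_aux G e he, hD, DG_add_aux, DG_add_aux]
    simp only [Pi.add_apply]
    rw [ih, ih, ih, Finset.sum_powerset_insert he]
    simp only [Finset.sum_powerset_insert he]
    simp only [← Finset.sum_add_distrib]
    refine Finset.sum_congr rfl fun s hs => Finset.sum_congr rfl fun t ht => ?_
    have hs' : e ∉ s := fun h => he (Finset.mem_powerset.1 hs h)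
    have ht' : e ∉ t := fun h => he (Finset.mem_powerset.1 ht h)
    have hst : e ∉ s ∪ t := by simp [hs', ht']
    have h0 : s ∪ t ≠ insert e G := fun h => hst (h ▸ Finset.mem_insert_self e G)
    have key : insert e (s ∪ t) = insert e G ↔ s ∪ t = G := by
      constructor
      · intro h
        rw [← Finset.erase_insert hst, h, Finset.erase_insert he]
      · intro h; rw [h]
    have h3 : insert e s ∪ insert e t = insert e (s ∪ t) := by
      ext z; simp only [Finset.mem_union, Finset.mem_insert]; tauto
    rw [h3, Finset.insert_union, Finset.union_insert, if_neg h0]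
    simp only [key, DG_insert_aux _ e hs', DG_insert_aux _ e ht']
    split_ifs <;> ring

/-- Second Leibniz formula for the Glauber derivative:
`(D_G (f·g))(a) = ∑_{G₁ ∪ G₂ = G} (D_{G₁} f)(a) · (D_{G₂} g)(a)`, the sum running over
all ordered pairs of subsets `G₁, G₂ ⊆ G` with `G₁ ∪ G₂ = G`. -/
theorem glauber_leibniz_two {E : Type*} [Fintype E] [DecidableEq E]
    (f g : (E → Bool) → ℝ) (G : Finset E) (a : E → Bool) :
    DG G (fun b => f b * g b) a
      = ∑ q ∈ (G.powerset ×ˢ G.powerset).filter (fun q => q.1 ∪ q.2 = G),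
          DG q.1 f a * DG q.2 g a := by
  rw [Finset.sum_filter, Finset.sum_product]
  exact leibniz_aux G f g a
end
end

section
/- Let E be a finite set and v : {0,1}^E → ℝ. For F ⊆ E and j ∈ ℤ define V(F, j) : {0,1}^E → ℝ by V(F, j) := ∑_{G ⊆ E∖F, |G| = j} D_{F∪G} v, with the convention V(F, j) := 0 whenever j < 0. Then for every e ∈ E, every integer k ≥ 1, and every configuration a ∈ {0,1}^E: ∑_{G ⊆ E, |G| = k−1} (D_G v)(a^e) = V(∅, k−1)(a) + V({e}, k−1)(a) − V({e}, k−2)(a). (This is Lemma 3.2 of the paper, stated there for v = ∇v_{m,ξ}; the identity is purely combinatorial and holds for any v.) -/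
noncomputable section

open Finset

variable {E : Type*} [DecidableEq E]

/-- `V(F, j) = ∑_{G ⊆ E∖F, |G| = j} D_{F∪G} v`, with the convention `V(F, j) = 0` for `j < 0`. -/
def Vfun {E : Type*} [Fintype E] [DecidableEq E] (v : (E → Bool) → ℝ)
    (F : Finset E) (j : ℤ) : (E → Bool) → ℝ :=
  if j < 0 then 0
  else ∑ G ∈ ((Finset.univ : Finset E) \ F).powersetCard j.toNat, DG (F ∪ G) v

theorem opn_comm' {E : Type*} [DecidableEq E] (a : E → Bool) (G H : Finset E) :
    opn (opn a G) H = opn (opn a H) G := by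
  funext x
  simp only [opn]
  split_ifs <;> rfl

theorem opn_idem' {E : Type*} [DecidableEq E] (a : E → Bool) (G : Finset E) :
    opn (opn a G) G = opn a G := by
  funext x
  simp only [opn]
  split_ifs <;> rfl

theorem D1_left_comm {E : Type*} [DecidableEq E] (x y : E) (f : (E → Bool) → ℝ) :
    D1 x (D1 y f) = D1 y (D1 x f) := by
  funext a
  simp only [D1]
  rw [opn_comm' a {x} {y}]
  ring

theorem DG_insert' {E : Type*} [DecidableEq E] (e : E) (G : Finset E) (h : e ∉ G)
    (f : (E → Bool) → ℝ) : DG (insert e G) f = D1 e (DG G f) := by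
  haveI : LeftCommutative (D1 (E := E) (β := ℝ)) := ⟨D1_left_comm⟩
  have := (Finset.toList_insert h).foldr_eq (f := D1 (E := E) (β := ℝ)) f
  simpa [DG] using this

theorem DG_opn_mem {E : Type*} [DecidableEq E] (e : E) (G : Finset E) (h : e ∉ G)
    (f : (E → Bool) → ℝ) (a : E → Bool) : DG (insert e G) f (opn a {e}) = 0 := by
  rw [DG_insert' e G h]
  simp [D1, opn_idem']

theorem DG_opn_not_mem {E : Type*} [DecidableEq E] (e : E) (G : Finset E) (h : e ∉ G)
    (f : (E → Bool) → ℝ) (a : E → Bool) :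
    DG G f (opn a {e}) = DG G f a + DG (insert e G) f a := by
  rw [DG_insert' e G h]
  simp [D1]

theorem sum_split {E : Type*} [Fintype E] [DecidableEq E] (e : E) (n : ℕ) (g : Finset E → ℝ) :
    ∑ G ∈ (Finset.univ : Finset E).powersetCard (n + 1), g G
      = ∑ G ∈ ((Finset.univ : Finset E) \ {e}).powersetCard (n + 1), g G
        + ∑ G ∈ ((Finset.univ : Finset E) \ {e}).powersetCard n, g (insert e G) := by
  have hu : (Finset.univ : Finset E) = insert e ((Finset.univ : Finset E) \ {e}) := by
    ext x; simp [em]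
  have he : e ∉ (Finset.univ : Finset E) \ {e} := by simp
  have hmem : ∀ m, ∀ G ∈ ((Finset.univ : Finset E) \ {e}).powersetCard m, e ∉ G := by
    intro m G hG h
    exact he ((Finset.mem_powersetCard.1 hG).1 h)
  conv_lhs => rw [hu]
  rw [Finset.powersetCard_succ_insert he, Finset.sum_union, Finset.sum_image]
  · intro G hG H hH hGH
    have h1 := hmem n G hG
    have h2 := hmem n H hH
    rw [← Finset.erase_insert h1, ← Finset.erase_insert h2]
    exact congrArg (fun s => Finset.erase s e) hGH
  · rw [Finset.disjoint_left]
    intro G hG hG'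
    obtain ⟨H, -, rfl⟩ := Finset.mem_image.1 hG'
    exact hmem _ _ hG (Finset.mem_insert_self e H)

/-- For every `e ∈ E`, every `k ≥ 1` and every configuration `a`,
`∑_{|G| = k−1} (D_G v)(a^e) = V(∅, k−1)(a) + V({e}, k−1)(a) − V({e}, k−2)(a)`
(Lemma 3.2 of the paper; a purely combinatorial identity). -/
theorem glauber_sum_opened_decomposition {E : Type*} [Fintype E] [DecidableEq E]
    (v : (E → Bool) → ℝ) (e : E) (k : ℕ) (hk : 1 ≤ k) (a : E → Bool) :
    ∑ G ∈ (Finset.univ : Finset E).powersetCard (k - 1), DG G v (opn a {e})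
      = Vfun v ∅ ((k : ℤ) - 1) a + Vfun v {e} ((k : ℤ) - 1) a
          - Vfun v {e} ((k : ℤ) - 2) a := by
  have hmem : ∀ m, ∀ G ∈ ((Finset.univ : Finset E) \ {e}).powersetCard m, e ∉ G := by
    intro m G hG h
    have := (Finset.mem_powersetCard.1 hG).1 h
    simp at this
  have hV : ∀ (F : Finset E) (n : ℕ), Vfun v F (n : ℤ) a
      = ∑ G ∈ ((Finset.univ : Finset E) \ F).powersetCard n, DG (F ∪ G) v a := by
    intro F n
    have : ¬ ((n : ℤ) < 0) := by omega
    simp [Vfun, this, Finset.sum_apply]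
  obtain ⟨n, rfl⟩ : ∃ n, k = n + 1 := ⟨k - 1, by omega⟩
  have e1 : (((n + 1 : ℕ) : ℤ) - 1) = (n : ℤ) := by push_cast; ring
  rw [e1, hV, hV, Nat.add_sub_cancel]
  simp only [Finset.sdiff_empty, Finset.empty_union, ← Finset.insert_eq]
  cases n with
  | zero =>
    have h0 : Vfun v {e} (((0 + 1 : ℕ) : ℤ) - 2) a = 0 := by simp [Vfun]
    rw [h0]
    simp only [Finset.powersetCard_zero, Finset.sum_singleton]
    rw [DG_opn_not_mem e ∅ (by simp)]
    ring
  | succ m =>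
    have e2 : (((m + 1 + 1 : ℕ) : ℤ) - 2) = (m : ℤ) := by push_cast; ring
    rw [e2, hV, sum_split e m, sum_split e m]
    simp only [← Finset.insert_eq]
    rw [Finset.sum_congr rfl (fun G hG => DG_opn_not_mem e G (hmem _ G hG) v a),
      Finset.sum_congr rfl (fun G hG => DG_opn_mem e G (hmem _ G hG) v a),
      Finset.sum_add_distrib, Finset.sum_const_zero]
    ring
end
end

section
/- Perturbed corrector equation (Lemma 3.4 of the paper, on a general finite graph): let (V, ∼) be a finite simple graph with edge set E and interior set V₀ ⊆ V, and let v : {0,1}^E → (V → ℝ) be such that for every configuration b ∈ {0,1}^E the function v(b) is b-harmonic at every x ∈ V₀. Fix a configuration a ∈ {0,1}^E, and for F ⊆ E, j ∈ ℤ define V(F, j) := ∑_{G ⊆ E∖F, |G| = j} (D_{F∪G} v)(a) (a function on V), with V(F, j) := 0 for j < 0. Define the antisymmetric edge field W(F, j)(x, y) := ∑_{e ∈ E∖F} (a^e − a)({x,y}) · (∇V(F, j−1)(x,y) − ∇V(F∪{e}, j−2)(x,y) + ∇V(F∪{e}, j−1)(x,y)) + ∑_{e ∈ F} (a^e − a)({x,y})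 · (∇V(F∖{e}, j)(x,y) − ∇V(F, j−1)(x,y)). Then for every F ⊆ E, every j ≥ 0, and every x ∈ V₀: − ∑_{y ∼ x} a^F({x,y}) (V(F,j)(y) − V(F,j)(x)) = (∇·W(F,j))(x). -/
noncomputable section

open Finset

variable {E : Type*} [DecidableEq E]

/-- The real-valued edge weight of a configuration `b : E → {0,1}` on the edge set of a
finite simple graph: `ew G b x y = b({x,y})` if `x ∼ y`, and `0` otherwise.  In particular
`ew G (opn a {e}) x y - ew G a x y` is the weight `(a^e − a)({x,y})`, which equals `1` exactly
when `{x,y} = e` and `a(e) = 0`, and `0` otherwise. -/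
def ew {V : Type*} (G : SimpleGraph V) [DecidableRel G.Adj]
    (b : G.edgeSet → Bool) (x y : V) : ℝ :=
  if h : G.Adj x y then (if b ⟨s(x, y), (G.mem_edgeSet).mpr h⟩ then 1 else 0) else 0

/-- `V(F, j) := ∑_{G ⊆ E∖F, |G| = j} (D_{F∪G} v)(a)` as a function on the vertices, with the
convention `V(F, j) = 0` for `j < 0`. -/
def VfG {V : Type*} [DecidableEq V] (G : SimpleGraph V) [Fintype G.edgeSet]
    [DecidableEq G.edgeSet] (v : (G.edgeSet → Bool) → V → ℝ) (a : G.edgeSet → Bool)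
    (F : Finset G.edgeSet) (j : ℤ) : V → ℝ :=
  if j < 0 then 0
  else ∑ Gs ∈ ((Finset.univ : Finset G.edgeSet) \ F).powersetCard j.toNat, DG (F ∪ Gs) v a

/-- The antisymmetric edge field `W(F, j)` of the perturbed corrector equation:
`W(F,j)(x,y) = ∑_{e ∈ E∖F} (a^e − a)({x,y}) (∇V(F,j−1) − ∇V(F∪{e},j−2) + ∇V(F∪{e},j−1))(x,y)
  + ∑_{e ∈ F} (a^e − a)({x,y}) (∇V(F∖{e},j) − ∇V(F,j−1))(x,y)`. -/
def WfG {V : Type*} [DecidableEq V] (G : SimpleGraph V) [DecidableRel G.Adj]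
    [Fintype G.edgeSet] [DecidableEq G.edgeSet] (v : (G.edgeSet → Bool) → V → ℝ)
    (a : G.edgeSet → Bool) (F : Finset G.edgeSet) (j : ℤ) (x y : V) : ℝ :=
  (∑ e ∈ (Finset.univ : Finset G.edgeSet) \ F,
      (ew G (opn a {e}) x y - ew G a x y) *
        ((VfG G v a F (j - 1) y - VfG G v a F (j - 1) x)
          - (VfG G v a (insert e F) (j - 2) y - VfG G v a (insert e F) (j - 2) x)
          + (VfG G v a (insert e F) (j - 1) y - VfG G v a (insert e F) (j - 1) x)))
    + ∑ e ∈ F,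
        (ew G (opn a {e}) x y - ew G a x y) *
          ((VfG G v a (F.erase e) j y - VfG G v a (F.erase e) j x)
            - (VfG G v a F (j - 1) y - VfG G v a F (j - 1) x))

theorem opn_comm (a : E → Bool) (e f : E) : opn (opn a {e}) {f} = opn (opn a {f}) {e} := by
  funext z
  simp only [opn]
  split_ifs <;> rfl

theorem D1_lc {β : Type*} [AddCommGroup β] :
    LeftCommutative (D1 : E → ((E → Bool) → β) → ((E → Bool) → β)) := by
  constructor
  intro e f g
  funext a
  simp only [D1]
  rw [opn_comm a e f]
  abel

theorem DG_insert {β : Type*} [AddCommGroup β] (e : E) (H : Finset E) (he : e ∉ H)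
    (f : (E → Bool) → β) (a : E → Bool) :
    DG (insert e H) f a = DG H f (opn a {e}) - DG H f a := by
  have h := (Finset.toList_insert he)
  have := D1_lc (E := E) (β := β)
  unfold DG
  rw [h.foldr_eq]
  rfl

theorem DG_empty {β : Type*} [AddCommGroup β] (f : (E → Bool) → β) (a : E → Bool) :
    DG ∅ f a = f a := by
  simp [DG]

theorem DG_hom {β γ : Type*} [AddCommGroup β] [AddCommGroup γ] (φ : β →+ γ) (H : Finset E)
    (f : (E → Bool) → β) (a : E → Bool) :
    DG H (fun b => φ (f b)) a = φ (DG H f a) := by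
  induction H using Finset.induction_on generalizing a with
  | empty => simp [DG_empty]
  | insert e H he ih => rw [DG_insert e H he, DG_insert e H he, ih, ih, map_sub]

theorem DG_zero {β : Type*} [AddCommGroup β] (H : Finset E) (a : E → Bool) :
    DG H (fun _ => (0 : β)) a = 0 := by
  induction H using Finset.induction_on generalizing a with
  | empty => simp [DG_empty]
  | insert e H he ih => rw [DG_insert e H he, ih, ih, sub_self]

theorem DG_sum {ι : Type*} (s : Finset ι) (H : Finset E)
    (f : ι → (E → Bool) → ℝ) (a : E → Bool) :
    DG H (fun b => ∑ i ∈ s, f i b) a = ∑ i ∈ s, DG H (f i) a := by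
  induction H using Finset.induction_on generalizing a with
  | empty => simp [DG_empty]
  | insert e H he ih =>
    rw [DG_insert e H he, ih, ih, ← Finset.sum_sub_distrib]
    exact Finset.sum_congr rfl fun i _ => (DG_insert e H he _ _).symm

def wt (e : E) (b : E → Bool) : ℝ := if b e then 1 else 0

theorem wt_opn (e : E) (b : E → Bool) (F : Finset E) :
    wt e (opn b F) = if e ∈ F then 1 else wt e b := by
  simp only [wt, opn]
  split_ifs <;> simp_all

theorem DG_mul (e0 : E) (g : (E → Bool) → ℝ) (H : Finset E) (a : E → Bool) :
    DG H (fun b => wt e0 b * g b) a =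
      if e0 ∈ H then DG H g a + (1 - wt e0 a) * DG (H.erase e0) g a else wt e0 a * DG H g a := by
  induction H using Finset.induction_on generalizing a with
  | empty => simp [DG_empty]
  | insert e H he ih =>
    rw [DG_insert e H he, ih, ih]
    by_cases h : e0 = e
    · subst h
      rw [if_neg he, if_neg he, if_pos (Finset.mem_insert_self _ _), Finset.erase_insert he,
        DG_insert e0 H he, wt_opn]
      simp only [Finset.mem_singleton, if_true]
      ring
    · have hw : wt e0 (opn a {e}) = wt e0 a := by
        rw [wt_opn, if_neg (by simpa using h)]
      rw [hw]
      by_cases h0 : e0 ∈ H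
      · rw [if_pos h0, if_pos h0, if_pos (Finset.mem_insert_of_mem h0),
          Finset.erase_insert_of_ne (Ne.symm h), DG_insert e H he,
          DG_insert e (H.erase e0) (fun hh => he (Finset.mem_of_mem_erase hh))]
        ring
      · rw [if_neg h0, if_neg h0, if_neg (by simp [h, h0]), DG_insert e H he]
        ring

def Sj (A : Finset E) (j : ℤ) (φ : Finset E → ℝ) : ℝ :=
  if j < 0 then 0 else ∑ Gs ∈ A.powersetCard j.toNat, φ Gs

theorem Sj_congr (A : Finset E) (j : ℤ) (φ ψ : Finset E → ℝ)
    (h : ∀ Gs, Gs ⊆ A → φ Gs = ψ Gs) : Sj A j φ = Sj A j ψ := by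
  unfold Sj
  split_ifs
  · rfl
  · exact Finset.sum_congr rfl fun Gs hG => h Gs (Finset.mem_powersetCard.1 hG).1

theorem Sj_add (A : Finset E) (j : ℤ) (φ ψ : Finset E → ℝ) :
    Sj A j (fun Gs => φ Gs + ψ Gs) = Sj A j φ + Sj A j ψ := by
  unfold Sj
  split_ifs
  · simp
  · exact Finset.sum_add_distrib

theorem Sj_mul (A : Finset E) (j : ℤ) (c : ℝ) (φ : Finset E → ℝ) :
    Sj A j (fun Gs => c * φ Gs) = c * Sj A j φ := by
  unfold Sj
  split_ifs
  · simp
  · exact (Finset.mul_sum _ _ _).symm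

theorem Sj_insert (A : Finset E) (e : E) (he : e ∉ A) (j : ℤ) (φ : Finset E → ℝ) :
    Sj (insert e A) j φ = Sj A j φ + Sj A (j - 1) (fun Gs => φ (insert e Gs)) := by
  unfold Sj
  rcases lt_trichotomy j 0 with h | h | h
  · rw [if_pos h, if_pos h, if_pos (by omega)]; simp
  · subst h; simp
  · obtain ⟨n, rfl⟩ : ∃ n : ℕ, j = n + 1 := ⟨(j - 1).toNat, by omega⟩
    rw [if_neg (by omega), if_neg (by omega), if_neg (by omega)]
    have h1 : ((n : ℤ) + 1).toNat = n + 1 := by omega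
    have h2 : ((n : ℤ) + 1 - 1).toNat = n := by omega
    rw [h1, h2, Finset.powersetCard_succ_insert he, Finset.sum_union, Finset.sum_image]
    · intro s hs t ht hst
      have hs' : e ∉ s := fun h => he ((Finset.mem_powersetCard.1 hs).1 h)
      have ht' : e ∉ t := fun h => he ((Finset.mem_powersetCard.1 ht).1 h)
      rw [← Finset.erase_insert hs', ← Finset.erase_insert ht', hst]
    · rw [Finset.disjoint_left]
      intro s hs hs2
      obtain ⟨t, ht, rfl⟩ := Finset.mem_image.1 hs2
      exact he ((Finset.mem_powersetCard.1 hs).1 (Finset.mem_insert_self _ _))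

/-- scalar version of `V(F,j)` -/
def Tj [Fintype E] (g : (E → Bool) → ℝ) (a : E → Bool) (F : Finset E) (j : ℤ) : ℝ :=
  Sj (Finset.univ \ F) j (fun Gs => DG (F ∪ Gs) g a)

theorem univ_sdiff_eq [Fintype E] (F : Finset E) (e : E) (he : e ∉ F) :
    (Finset.univ \ F : Finset E) = insert e (Finset.univ \ insert e F) := by
  ext z
  by_cases h : z = e
  · subst h; simp [he]
  · simp [h]

theorem Tj_rec [Fintype E] (g : (E → Bool) → ℝ) (a : E → Bool) (F : Finset E) (e : E)
    (he : e ∉ F) (j : ℤ) :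
    Tj g a F j = Sj (Finset.univ \ insert e F) j (fun Gs => DG (F ∪ Gs) g a)
      + Tj g a (insert e F) (j - 1) := by
  unfold Tj
  rw [univ_sdiff_eq F e he, Sj_insert _ _ (by simp)]
  congr 2
  funext Gs
  rw [Finset.union_insert, Finset.insert_union]

theorem key [Fintype E] (g : (E → Bool) → ℝ) (a : E → Bool) (F : Finset E) (e0 : E) (j : ℤ) :
    Tj (fun b => wt e0 b * g b) a F j = wt e0 (opn a F) * Tj g a F j
      + (if e0 ∈ F then (1 - wt e0 a) * (Tj g a (F.erase e0) j - Tj g a F (j - 1))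
        else (1 - wt e0 a) *
          (Tj g a F (j - 1) - Tj g a (insert e0 F) (j - 2) + Tj g a (insert e0 F) (j - 1))) := by
  rw [wt_opn]
  by_cases h : e0 ∈ F
  · rw [if_pos h, if_pos h, Tj_rec g a (F.erase e0) e0 (Finset.notMem_erase _ _) j,
      Finset.insert_erase h, add_sub_cancel_right, ← Sj_mul, one_mul]
    unfold Tj
    rw [← Sj_add]
    apply Sj_congr
    intro Gs hG
    have h1 : e0 ∉ Gs := fun hh => by simpa [h] using hG hh
    rw [DG_mul, if_pos (Finset.mem_union_left _ h), Finset.erase_union_distrib,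
      Finset.erase_eq_of_notMem h1]
  · rw [if_neg h, if_neg h, Tj_rec _ a F e0 h j, Tj_rec g a F e0 h j, Tj_rec g a F e0 h (j - 1)]
    have e1 : Sj (Finset.univ \ insert e0 F) j
        (fun Gs => DG (F ∪ Gs) (fun b => wt e0 b * g b) a)
        = wt e0 a * Sj (Finset.univ \ insert e0 F) j (fun Gs => DG (F ∪ Gs) g a) := by
      rw [← Sj_mul]
      apply Sj_congr
      intro Gs hG
      have h1 : e0 ∉ Gs := fun hh => by simpa using hG hh
      rw [DG_mul, if_neg (by simp [h, h1])]
    have e2 : Tj (fun b => wt e0 b * g b) a (insert e0 F) (j - 1)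
        = Tj g a (insert e0 F) (j - 1) + (1 - wt e0 a) *
          Sj (Finset.univ \ insert e0 F) (j - 1) (fun Gs => DG (F ∪ Gs) g a) := by
      unfold Tj
      rw [← Sj_mul, ← Sj_add]
      apply Sj_congr
      intro Gs hG
      have h1 : e0 ∉ Gs := fun hh => by simpa using hG hh
      rw [DG_mul, if_pos (by simp), Finset.insert_union, Finset.erase_insert (by simp [h, h1])]
    rw [e1, e2, show j - 1 - 1 = j - 2 by ring]
    ring

theorem VfG_grad {V : Type*} [DecidableEq V] (G : SimpleGraph V) [Fintype G.edgeSet]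
    [DecidableEq G.edgeSet] (v : (G.edgeSet → Bool) → V → ℝ) (a : G.edgeSet → Bool)
    (F : Finset G.edgeSet) (j : ℤ) (x y : V) :
    VfG G v a F j y - VfG G v a F j x = Tj (fun b => v b y - v b x) a F j := by
  unfold VfG Tj Sj
  split_ifs
  · simp
  · rw [Finset.sum_apply, Finset.sum_apply, ← Finset.sum_sub_distrib]
    refine Finset.sum_congr rfl fun Gs _ => ?_
    exact (DG_hom (Pi.evalAddMonoidHom (fun _ : V => ℝ) y
      - Pi.evalAddMonoidHom (fun _ : V => ℝ) x) (F ∪ Gs) v a).symm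

theorem pointwise {V : Type*} [DecidableEq V] (G : SimpleGraph V) [DecidableRel G.Adj]
    [Fintype G.edgeSet] [DecidableEq G.edgeSet] (v : (G.edgeSet → Bool) → V → ℝ)
    (a : G.edgeSet → Bool) (F : Finset G.edgeSet) (j : ℤ) (x y : V) :
    Tj (fun b => ew G b x y * (v b y - v b x)) a F j
      = ew G (opn a F) x y * (VfG G v a F j y - VfG G v a F j x) + WfG G v a F j x y := by
  unfold WfG
  simp only [VfG_grad]
  by_cases h : G.Adj x y
  · have hw : ∀ b, ew G b x y = wt (⟨s(x, y), (G.mem_edgeSet).mpr h⟩ : G.edgeSet) b := by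
      intro b
      simp [ew, wt, h]
    simp only [hw]
    generalize (⟨s(x, y), (G.mem_edgeSet).mpr h⟩ : G.edgeSet) = e0
    rw [key]
    congr 1
    have hd : ∀ e, wt e0 (opn a {e}) - wt e0 a = if e0 = e then 1 - wt e0 a else 0 := by
      intro e
      rw [wt_opn]
      by_cases he : e0 = e <;> simp [he]
    simp only [hd, ite_mul, zero_mul, Finset.sum_ite_eq]
    by_cases hF : e0 ∈ F <;> simp [hF]
  · have hw : ∀ b, ew G b x y = 0 := by
      intro b
      simp [ew, h]
    simp only [hw]
    simp [Tj, DG_zero, Sj]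

/-- Lemma 3.4 of the paper.  Perturbed corrector equation on a finite simple
graph: if `v(b)` is `b`-harmonic on the interior `V₀` for every configuration `b`, then for
every `F ⊆ E`, every `j ≥ 0` and every interior vertex `x`,
`− ∑_{y ∼ x} a^F({x,y}) (V(F,j)(y) − V(F,j)(x)) = (∇·W(F,j))(x)`. -/
theorem perturbed_corrector_equation {V : Type*} [Fintype V] [DecidableEq V]
    (G : SimpleGraph V) [DecidableRel G.Adj] [Fintype G.edgeSet]
    (V₀ : Set V) (v : (G.edgeSet → Bool) → V → ℝ)
    (hharm : ∀ b : G.edgeSet → Bool, ∀ x ∈ V₀, ∑ y, ew G b x y * (v b y - v b x) = 0)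
    (a : G.edgeSet → Bool) (F : Finset G.edgeSet) (j : ℤ) (hj : 0 ≤ j)
    (x : V) (hx : x ∈ V₀) :
    -∑ y, ew G (opn a F) x y * (VfG G v a F j y - VfG G v a F j x)
      = ∑ y, WfG G v a F j x y := by
  have hsum : ∑ y, Tj (fun b => ew G b x y * (v b y - v b x)) a F j = 0 := by
    unfold Tj Sj
    simp only [if_neg (not_lt.2 hj)]
    rw [Finset.sum_comm]
    refine Finset.sum_eq_zero fun Gs _ => ?_
    rw [← DG_sum]
    simp only [hharm _ x hx]
    exact DG_zero _ _
  simp only [pointwise, Finset.sum_add_distrib] at hsum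
  linarith
end
end

section
/- Hole-separation bound: let E be a finite set, v : {0,1}^E → ℝ, and E' ⊆ E. With V(F, j) := ∑_{G ⊆ E∖F, |G| = j} D_{F∪G} v and V'(F, j | E') := ∑_{G ⊆ (E∖F)∖E', |G| = j} D_{F∪G} v (both equal to 0 for j < 0), one has for every F ⊆ E, every j ≥ 0, and every configuration a ∈ {0,1}^E: |V(F, j)(a)|² ≤ (j+1) · ∑_{ℓ=0}^{j} |E'|^ℓ · ∑_{G ⊆ E'∖F, |G| = ℓ} |V'(F∪G, j−ℓ | E')(a)|². -/
noncomputable section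

open Finset

variable {E : Type*} [DecidableEq E]

/-- `V'(F, j | E') = ∑_{G ⊆ (E∖F)∖E', |G| = j} D_{F∪G} v`, the hole-separated version,
with the convention `V'(F, j | E') = 0` for `j < 0`. -/
def Vsep {E : Type*} [Fintype E] [DecidableEq E] (v : (E → Bool) → ℝ) (E' : Finset E)
    (F : Finset E) (j : ℤ) : (E → Bool) → ℝ :=
  if j < 0 then 0
  else ∑ G ∈ (((Finset.univ : Finset E) \ F) \ E').powersetCard j.toNat, DG (F ∪ G) v

/-- Splitting a sum over `j`-subsets according to the trace on a subset. -/
theorem sum_split_aux {E : Type*} [DecidableEq E] (A B : Finset E) (hAB : Disjoint A B) (j : ℕ)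
    (g : Finset E → ℝ) :
    ∑ H ∈ (A ∪ B).powersetCard j, g H
      = ∑ l ∈ Finset.range (j + 1), ∑ G ∈ A.powersetCard l,
          ∑ K ∈ B.powersetCard (j - l), g (G ∪ K) := by
  have h1 : ∀ l ∈ Finset.range (j + 1), ∑ G ∈ A.powersetCard l,
      ∑ K ∈ B.powersetCard (j - l), g (G ∪ K)
      = ∑ p ∈ A.powersetCard l ×ˢ B.powersetCard (j - l), g (p.1 ∪ p.2) := by
    intro l _
    rw [Finset.sum_product]
  rw [Finset.sum_congr rfl h1, Finset.sum_sigma']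
  have hd := Finset.disjoint_left.mp hAB
  refine Finset.sum_bij' (fun H _ => ⟨(H ∩ A).card, (H ∩ A, H \ A)⟩)
    (fun x _ => x.2.1 ∪ x.2.2) ?_ ?_ ?_ ?_ ?_
  · intro H hH
    rw [Finset.mem_powersetCard] at hH
    have hc := Finset.card_inter_add_card_sdiff H A
    simp only [Finset.mem_sigma, Finset.mem_range, Finset.mem_product, Finset.mem_powersetCard]
    refine ⟨by omega, ⟨Finset.inter_subset_right, by trivial⟩, ?_, by omega⟩
    intro x hx
    have := @hH.1 x
    grind
  · rintro ⟨l, G, K⟩ hx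
    simp only [Finset.mem_sigma, Finset.mem_range, Finset.mem_product,
      Finset.mem_powersetCard] at hx ⊢
    obtain ⟨hl, ⟨hG, hGc⟩, hK, hKc⟩ := hx
    refine ⟨Finset.union_subset_union hG hK, ?_⟩
    rw [Finset.card_union_of_disjoint (Finset.disjoint_of_subset_left hG
      (Finset.disjoint_of_subset_right hK hAB))]
    omega
  · intro H hH
    ext x
    simp only [Finset.mem_union, Finset.mem_inter, Finset.mem_sdiff]
    tauto
  · rintro ⟨l, G, K⟩ hx
    simp only [Finset.mem_sigma, Finset.mem_range, Finset.mem_product,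
      Finset.mem_powersetCard] at hx
    obtain ⟨hl, ⟨hG, hGc⟩, hK, hKc⟩ := hx
    have e1 : (G ∪ K) ∩ A = G := by
      ext x
      have := @hG x
      have := @hK x
      have := @hd x
      grind
    have e2 : (G ∪ K) \ A = K := by
      ext x
      have := @hG x
      have := @hK x
      have := @hd x
      grind
    simp only [e1, e2, hGc]
  · intro H hH
    congr 1
    ext x
    simp only [Finset.mem_union, Finset.mem_inter, Finset.mem_sdiff]
    tauto

/-- Hole-separation bound: for every `F ⊆ E`, every `j ≥ 0` and every
configuration `a`,
`|V(F, j)(a)|² ≤ (j+1) ∑_{ℓ=0}^{j} |E'|^ℓ ∑_{G ⊆ E'∖F, |G| = ℓ} |V'(F∪G, j−ℓ | E')(a)|²`. -/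
theorem hole_separation_bound {E : Type*} [Fintype E] [DecidableEq E]
    (v : (E → Bool) → ℝ) (E' : Finset E) (F : Finset E) (j : ℕ) (a : E → Bool) :
    (Vfun v F (j : ℤ) a) ^ 2
      ≤ ((j : ℝ) + 1) * ∑ l ∈ Finset.range (j + 1), (E'.card : ℝ) ^ l *
          ∑ G ∈ (E' \ F).powersetCard l, (Vsep v E' (F ∪ G) ((j : ℤ) - l) a) ^ 2 := by
  have key : Vfun v F (j : ℤ) a = ∑ l ∈ Finset.range (j + 1),
      ∑ G ∈ (E' \ F).powersetCard l, Vsep v E' (F ∪ G) ((j : ℤ) - l) a := by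
    have hu : (Finset.univ : Finset E) \ F = (E' \ F) ∪ ((Finset.univ \ F) \ E') := by
      ext x
      simp only [Finset.mem_union, Finset.mem_sdiff, Finset.mem_univ, true_and]
      tauto
    have hdis : Disjoint (E' \ F) ((Finset.univ \ F) \ E') := by
      rw [Finset.disjoint_left]
      intro x
      simp only [Finset.mem_sdiff]
      tauto
    unfold Vfun
    rw [if_neg (by omega), Finset.sum_apply, Int.toNat_natCast, hu, sum_split_aux _ _ hdis j]
    refine Finset.sum_congr rfl fun l hl => Finset.sum_congr rfl fun G hG => ?_
    rw [Finset.mem_range] at hl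
    rw [Finset.mem_powersetCard] at hG
    unfold Vsep
    have e : (Finset.univ \ (F ∪ G)) \ E' = (Finset.univ \ F) \ E' := by
      ext x
      have := @hG.1 x
      simp only [Finset.mem_union, Finset.mem_sdiff, Finset.mem_univ, true_and] at this ⊢
      tauto
    have e2 : ((j : ℤ) - l).toNat = j - l := by omega
    rw [if_neg (by omega), Finset.sum_apply, e, e2]
    refine Finset.sum_congr rfl fun K _ => ?_
    rw [Finset.union_assoc]
  rw [key]
  refine (sq_sum_le_card_mul_sum_sq).trans ?_
  rw [Finset.card_range]
  push_cast
  refine mul_le_mul_of_nonneg_left (Finset.sum_le_sum fun l _ => ?_) (by positivity)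
  refine (sq_sum_le_card_mul_sum_sq).trans ?_
  refine mul_le_mul_of_nonneg_right ?_ (Finset.sum_nonneg fun _ _ => sq_nonneg _)
  rw [Finset.card_powersetCard]
  have h1 : (E' \ F).card ≤ E'.card := Finset.card_le_card Finset.sdiff_subset
  exact_mod_cast (Nat.choose_le_pow _ l).trans (Nat.pow_le_pow_left h1 l)
end
end

section
/- Quantitative convergence of derivatives (Lemma 8.1 of the paper, quantitative part): let I ⊆ ℝ be an open interval, ν : I → ℝ, and (ν_L)_{L ≥ 1} functions I → ℝ such that: (2) every ν_L is infinitely differentiable on I; (3) for every k ∈ ℕ and every ρ₀ ∈ I there exist a neighborhood J ⊆ I of ρ₀ and a finite M with |ν_L^{(k)}(ρ)| ≤ M for all L and ρ ∈ J; and (1+) there exists α > 0 such that for every compact K ⊆ I there is a finite C₀ with sup_{ρ ∈ K} |ν_L(ρ) − ν(ρ)| ≤ C₀ · L^{−α} for all integers L ≥ 1. Then ν is infinitely differentiable on I, and for every k ∈ ℕ, every α' ∈ (0, α), and every compact K ⊆ I there exists a finite C' with sup_{ρ ∈ K} |ν_L^{(k)}(ρ) − ν^{(k)}(ρ)| ≤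 C' · L^{−α'} for all integers L ≥ 1. -/
open Filter

/-- Rate property: on compacts of `I`, `|F i| ≤ C * N i ^ (-β)`. -/
def RateOn {ι : Type} (I : Set ℝ) (N : ι → ℝ) (F : ι → ℝ → ℝ) (β : ℝ) : Prop :=
  ∀ K : Set ℝ, K ⊆ I → IsCompact K → ∃ C : ℝ, 0 ≤ C ∧
    ∀ i, ∀ x ∈ K, |F i x| ≤ C * (N i) ^ (-β)

lemma RateOn.mono {ι : Type} {I : Set ℝ} {N : ι → ℝ} (hN : ∀ i, 1 ≤ N i)
    {F : ι → ℝ → ℝ} {β γ : ℝ} (h : RateOn I N F β) (hγ : γ ≤ β) : RateOn I N F γ := by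
  intro K hK hc
  obtain ⟨C, hC, hb⟩ := h K hK hc
  refine ⟨C, hC, fun i x hx => (hb i x hx).trans ?_⟩
  exact mul_le_mul_of_nonneg_left
    (Real.rpow_le_rpow_of_exponent_le (hN i) (by linarith)) hC

lemma RateOn.landau {ι : Type} {I : Set ℝ} (hI : IsOpen I) {N : ι → ℝ} (hN : ∀ i, 1 ≤ N i)
    {f f' f'' : ι → ℝ → ℝ}
    (h1 : ∀ i, ∀ x ∈ I, HasDerivAt (f i) (f' i x) x)
    (h2 : ∀ i, ∀ x ∈ I, HasDerivAt (f' i) (f'' i x) x)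
    {β γ : ℝ} (hγβ : γ ≤ β) (hf : RateOn I N f β) (hf'' : RateOn I N f'' γ) :
    RateOn I N f' ((β + γ) / 2) := by
  intro K hK hc
  obtain ⟨δ, hδ, hsub⟩ := hc.exists_cthickening_subset_open hI hK
  have hc' : IsCompact (Metric.cthickening δ K) := hc.cthickening
  obtain ⟨A, hA, hfb⟩ := hf _ hsub hc'
  obtain ⟨B, hB, hfb''⟩ := hf'' _ hsub hc'
  refine ⟨2 * A / δ + B * δ, by positivity, fun i x hx => ?_⟩
  have hNpos : 0 < N i := lt_of_lt_of_le one_pos (hN i)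
  set t : ℝ := (N i) ^ (-((β - γ) / 2)) with ht
  have htpos : 0 < t := Real.rpow_pos_of_pos hNpos _
  have ht1 : t ≤ 1 := Real.rpow_le_one_of_one_le_of_nonpos (hN i) (by linarith)
  set u : ℝ := (N i) ^ (-((β + γ) / 2)) with hu
  have hupos : 0 < u := Real.rpow_pos_of_pos hNpos _
  have e1 : (N i) ^ (-β) = u * t := by
    rw [hu, ht, ← Real.rpow_add hNpos]; congr 1; ring
  have e2 : (N i) ^ (-γ) * t = u := by
    rw [hu, ht, ← Real.rpow_add hNpos]; congr 1; ring
  set h : ℝ := δ * t with hh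
  have hpos : 0 < h := by positivity
  have hle : h ≤ δ := by nlinarith
  have hseg : ∀ y ∈ Set.Icc x (x + h), y ∈ Metric.cthickening δ K := by
    intro y hy
    refine Metric.mem_cthickening_of_dist_le y x δ K hx ?_
    rw [Real.dist_eq, abs_of_nonneg (by linarith [hy.1])]
    linarith [hy.2]
  have hsegI : ∀ y ∈ Set.Icc x (x + h), y ∈ I := fun y hy => hsub (hseg y hy)
  obtain ⟨ξ, hξ, hξe⟩ := exists_hasDerivAt_eq_slope (f i) (f' i) (by linarith : x < x + h)
    (fun y hy => (h1 i y (hsegI y hy)).continuousAt.continuousWithinAt)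
    (fun y hy => h1 i y (hsegI y (Set.Ioo_subset_Icc_self hy)))
  obtain ⟨η, hη, hηe⟩ := exists_hasDerivAt_eq_slope (f' i) (f'' i) hξ.1
    (fun y hy => (h2 i y (hsegI y ⟨hy.1, hy.2.trans hξ.2.le⟩)).continuousAt.continuousWithinAt)
    (fun y hy => h2 i y (hsegI y ⟨hy.1.le, (hy.2.trans hξ.2).le⟩))
  have hxξ : 0 < ξ - x := sub_pos.2 hξ.1
  rw [eq_div_iff hxξ.ne'] at hηe
  have b1 := hfb i x (hseg x ⟨le_refl _, by linarith⟩)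
  have b2 := hfb i (x + h) (hseg _ ⟨by linarith, le_refl _⟩)
  have b3 := hfb'' i η (hseg η ⟨hη.1.le, (hη.2.trans hξ.2).le⟩)
  have c1 : |f' i ξ| ≤ 2 * A / δ * u := by
    have : x + h - x = h := by ring
    rw [hξe, this, abs_div, abs_of_pos hpos, div_le_iff₀ hpos]
    have e3 : 2 * A / δ * u * h = 2 * (A * (u * t)) := by
      rw [hh]; field_simp
    rw [e3, ← e1]
    have := abs_sub (f i (x + h)) (f i x)
    linarith
  have c2 : |f' i ξ - f' i x| ≤ B * δ * u := by
    rw [← hηe, abs_mul, abs_of_pos hxξ]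
    calc |f'' i η| * (ξ - x) ≤ (B * (N i) ^ (-γ)) * h :=
          mul_le_mul b3 (by linarith [hξ.2]) hxξ.le (by positivity)
      _ = B * δ * ((N i) ^ (-γ) * t) := by rw [hh]; ring
      _ = B * δ * u := by rw [e2]
  have c3 : |f' i x| ≤ |f' i ξ| + |f' i ξ - f' i x| := by
    have := abs_sub (f' i ξ) (f' i ξ - f' i x)
    simpa using this
  calc |f' i x| ≤ _ := c3
    _ ≤ 2 * A / δ * u + B * δ * u := add_le_add c1 c2
    _ = _ := by ring

lemma RateOn.step {ι : Type} {I : Set ℝ} (hI : IsOpen I) {N : ι → ℝ} (hN : ∀ i, 1 ≤ N i)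
    {F : ℕ → ι → ℝ → ℝ}
    (hd : ∀ k i, ∀ x ∈ I, HasDerivAt (F k i) (F (k + 1) i x) x)
    (h0 : ∀ k, RateOn I N (F k) 0) (n : ℕ) :
    ∀ k β, 0 ≤ β → RateOn I N (F k) β → RateOn I N (F (k + 1)) (β * (n / (n + 2))) := by
  induction n with
  | zero => intro k β _ _; simpa using h0 (k + 1)
  | succ n ih =>
    intro k β hβ hk
    have hn : (0 : ℝ) ≤ n / (n + 2) := by positivity
    have hn1 : (n : ℝ) / (n + 2) ≤ 1 := by
      rw [div_le_one (by positivity)]; linarith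
    have a1 := ih k β hβ hk
    have a2 := ih (k + 1) _ (by positivity) a1
    have hle : β * ((n : ℝ) / (n + 2)) * (n / (n + 2)) ≤ β := by
      have : (n : ℝ) / (n + 2) * (n / (n + 2)) ≤ 1 := mul_le_one₀ hn1 hn hn1
      nlinarith
    refine (RateOn.landau hI hN (hd k) (hd (k + 1)) hle hk a2).mono hN ?_
    have key : ((n + 1 : ℕ) : ℝ) / ((n + 1 : ℕ) + 2) ≤
        (1 + (n : ℝ) / (n + 2) * (n / (n + 2))) / 2 := by
      push_cast
      have hp : (0 : ℝ) < n + 2 := by positivity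
      have hp' : (0 : ℝ) < n + 1 + 2 := by positivity
      have : (1 + (n : ℝ) / (n + 2) * (n / (n + 2))) / 2 - (n + 1) / (n + 1 + 2)
          = 2 / ((n + 2) ^ 2 * (n + 1 + 2)) := by
        field_simp; ring
      have h2 : (0 : ℝ) ≤ 2 / ((n + 2) ^ 2 * (n + 1 + 2)) := by positivity
      linarith
    have := mul_le_mul_of_nonneg_left key hβ
    linarith

lemma RateOn.all {ι : Type} {I : Set ℝ} (hI : IsOpen I) {N : ι → ℝ} (hN : ∀ i, 1 ≤ N i)
    {F : ℕ → ι → ℝ → ℝ}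
    (hd : ∀ k i, ∀ x ∈ I, HasDerivAt (F k i) (F (k + 1) i x) x)
    (h0 : ∀ k, RateOn I N (F k) 0) {α : ℝ} (hα : RateOn I N (F 0) α) (k : ℕ) :
    ∀ β, 0 < β → β < α → RateOn I N (F k) β := by
  induction k with
  | zero => intro β _ h; exact hα.mono hN h.le
  | succ k ih =>
    intro β hβ hβα
    obtain ⟨β', h1, h2⟩ := exists_between hβα
    have hβ' : 0 < β' := hβ.trans h1
    obtain ⟨n, hn⟩ := exists_nat_gt (2 * β / (β' - β))
    refine (RateOn.step hI hN hd h0 n k β' hβ'.le (ih β' hβ' h2)).mono hN ?_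
    rw [div_lt_iff₀ (by linarith)] at hn
    rw [← mul_div_assoc, le_div_iff₀ (by positivity)]
    nlinarith

/-- Lemma 8.1 of the paper, quantitative part.  Let `I ⊆ ℝ` be an open
interval, `ν : I → ℝ`, and `(ν_L)_{L ≥ 1}` functions on `I` such that (2) each `ν_L` is
infinitely differentiable on `I`; (3) for each `k` the `k`-th derivatives of the `ν_L` are
locally uniformly bounded on `I`; and (1+) for some `α > 0`, on every compact `K ⊆ I` one has
`sup_K |ν_L − ν| ≤ C₀ L^{−α}`.  Then `ν` is infinitely differentiable on `I` and for every
`k`, every `α' ∈ (0, α)` and every compact `K ⊆ I` there is `C'` with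
`sup_K |ν_L^{(k)} − ν^{(k)}| ≤ C' L^{−α'}` for all `L ≥ 1`. -/
theorem derivs_converge_of_polynomial_rate
    (I : Set ℝ) (hIopen : IsOpen I) (hIconn : I.OrdConnected)
    (ν : ℝ → ℝ) (νL : ℕ → ℝ → ℝ) (α : ℝ) (hα : 0 < α)
    (h2 : ∀ L : ℕ, ContDiffOn ℝ (⊤ : ℕ∞) (νL L) I)
    (h3 : ∀ k : ℕ, ∀ ρ₀ ∈ I, ∃ J ∈ nhds ρ₀, J ⊆ I ∧ ∃ M : ℝ,
        ∀ L : ℕ, ∀ ρ ∈ J, |iteratedDerivWithin k (νL L) I ρ| ≤ M)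
    (h1plus : ∀ K : Set ℝ, K ⊆ I → IsCompact K → ∃ C₀ : ℝ,
        ∀ L : ℕ, 1 ≤ L → ∀ ρ ∈ K, |νL L ρ - ν ρ| ≤ C₀ * (L : ℝ) ^ (-α)) :
    ContDiffOn ℝ (⊤ : ℕ∞) ν I ∧
      ∀ k : ℕ, ∀ α' ∈ Set.Ioo (0 : ℝ) α, ∀ K : Set ℝ, K ⊆ I → IsCompact K →
        ∃ C' : ℝ, ∀ L : ℕ, 1 ≤ L → ∀ ρ ∈ K,
          |iteratedDerivWithin k (νL L) I ρ - iteratedDerivWithin k ν I ρ|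
            ≤ C' * (L : ℝ) ^ (-α') := by
  classical
  have hU : UniqueDiffOn ℝ I := hIopen.uniqueDiffOn
  -- derivatives of the νL
  have hder : ∀ k L, ∀ x ∈ I, HasDerivAt (iteratedDerivWithin k (νL L) I)
      (iteratedDerivWithin (k + 1) (νL L) I x) x := by
    intro k L x hx
    have hdiff : DifferentiableOn ℝ (iteratedDerivWithin k (νL L) I) I :=
      (h2 L).differentiableOn_iteratedDerivWithin
        (by exact_mod_cast (WithTop.coe_lt_top k)) hU
    have := (hdiff x hx).hasDerivWithinAt
    rw [iteratedDerivWithin_succ]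
    exact this.hasDerivAt (hIopen.mem_nhds hx)
  -- bounds on compacts
  have hbd : ∀ k : ℕ, ∀ K : Set ℝ, K ⊆ I → IsCompact K → ∃ M : ℝ, 0 ≤ M ∧
      ∀ L : ℕ, ∀ x ∈ K, |iteratedDerivWithin k (νL L) I x| ≤ M := by
    intro k K hK hc
    refine hc.induction_on (p := fun S => ∃ M : ℝ, 0 ≤ M ∧
      ∀ L : ℕ, ∀ x ∈ S, |iteratedDerivWithin k (νL L) I x| ≤ M) ⟨0, le_refl _, by simp⟩ ?_ ?_ ?_
    · rintro s t hst ⟨M, hM, h⟩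
      exact ⟨M, hM, fun L x hx => h L x (hst hx)⟩
    · rintro s t ⟨M, hM, h⟩ ⟨M', hM', h'⟩
      refine ⟨M + M', by positivity, fun L x hx => ?_⟩
      rcases hx with hx | hx
      · linarith [h L x hx]
      · linarith [h' L x hx]
    · intro x hx
      obtain ⟨J, hJ, -, M, hM⟩ := h3 k x (hK hx)
      exact ⟨J, mem_nhdsWithin_of_mem_nhds hJ, |M|, abs_nonneg _,
        fun L y hy => (hM L y hy).trans (le_abs_self M)⟩
  let ι : Type := {p : ℕ × ℕ // 1 ≤ p.1 ∧ p.1 ≤ p.2}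
  let N : ι → ℝ := fun p => (p.1.1 : ℝ)
  have hN : ∀ i : ι, 1 ≤ N i := fun i => by
    have := i.2.1
    show (1 : ℝ) ≤ (i.1.1 : ℝ)
    exact_mod_cast this
  let F : ℕ → ι → ℝ → ℝ := fun k p x =>
    iteratedDerivWithin k (νL p.1.1) I x - iteratedDerivWithin k (νL p.1.2) I x
  have hFd : ∀ k i, ∀ x ∈ I, HasDerivAt (F k i) (F (k + 1) i x) x := fun k i x hx =>
    (hder k i.1.1 x hx).sub (hder k i.1.2 x hx)
  have hF0 : ∀ k, RateOn I N (F k) 0 := by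
    intro k K hK hc
    obtain ⟨M, hM, hb⟩ := hbd k K hK hc
    refine ⟨2 * M, by positivity, fun i x hx => ?_⟩
    have h1 := hb i.1.1 x hx
    have h2 := hb i.1.2 x hx
    have h3 := abs_sub (iteratedDerivWithin k (νL i.1.1) I x)
      (iteratedDerivWithin k (νL i.1.2) I x)
    simp only [neg_zero, Real.rpow_zero, mul_one]
    show |iteratedDerivWithin k (νL i.1.1) I x - iteratedDerivWithin k (νL i.1.2) I x| ≤ _
    linarith
  have hFα : RateOn I N (F 0) α := by
    intro K hK hc
    obtain ⟨C, hC⟩ := h1plus K hK hc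
    refine ⟨2 * |C|, by positivity, fun i x hx => ?_⟩
    have hNi := hN i
    have hpos : (0 : ℝ) < N i := by linarith
    have p1 := hC i.1.1 i.2.1 x hx
    have p2 := hC i.1.2 (i.2.1.trans i.2.2) x hx
    have hle : N i ≤ (i.1.2 : ℝ) := by
      show (i.1.1 : ℝ) ≤ (i.1.2 : ℝ)
      exact_mod_cast i.2.2
    have hr : (i.1.2 : ℝ) ^ (-α) ≤ (N i) ^ (-α) :=
      Real.rpow_le_rpow_of_nonpos hpos hle (by linarith)
    have hr0 : 0 ≤ (i.1.2 : ℝ) ^ (-α) := by positivity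
    have q1 : |νL i.1.1 x - ν x| ≤ |C| * (N i) ^ (-α) :=
      p1.trans (mul_le_mul_of_nonneg_right (le_abs_self C) (by positivity))
    have q2 : |νL i.1.2 x - ν x| ≤ |C| * (N i) ^ (-α) :=
      p2.trans ((mul_le_mul_of_nonneg_right (le_abs_self C) hr0).trans
        (mul_le_mul_of_nonneg_left hr (abs_nonneg C)))
    have h3 := abs_sub (νL i.1.1 x - ν x) (νL i.1.2 x - ν x)
    have e : F 0 i x = (νL i.1.1 x - ν x) - (νL i.1.2 x - ν x) := by
      simp [F]
    rw [e]
    linarith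
  have hF := RateOn.all hIopen hN hFd hF0 hFα
  have hlim0 : ∀ (C β : ℝ), 0 < β →
      Tendsto (fun L : ℕ => C * (L : ℝ) ^ (-β)) atTop (nhds 0) := by
    intro C β hβ
    have := ((tendsto_rpow_neg_atTop hβ).comp tendsto_natCast_atTop_atTop).const_mul C
    simpa using this
  -- pointwise limits
  have hex : ∀ k : ℕ, ∀ x : ℝ, ∃ g : ℝ, x ∈ I →
      Tendsto (fun L => iteratedDerivWithin k (νL L) I x) atTop (nhds g) := by
    intro k x
    by_cases hx : x ∈ I
    swap
    · exact ⟨0, fun h => absurd h hx⟩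
    obtain ⟨C, hC, hb⟩ := hF k (α / 2) (by linarith) (by linarith) {x}
      (by simpa using hx) isCompact_singleton
    have hcs : CauchySeq (fun L => iteratedDerivWithin k (νL (L + 1)) I x) := by
      refine cauchySeq_of_le_tendsto_0' (fun L : ℕ => C * ((L + 1 : ℕ) : ℝ) ^ (-(α / 2))) ?_ ?_
      · intro n m hnm
        rw [Real.dist_eq]
        exact hb ⟨(n + 1, m + 1), by simp, by simpa using hnm⟩ x rfl
      · exact (hlim0 C (α / 2) (by linarith)).comp (tendsto_add_atTop_nat 1)
    obtain ⟨g, hg⟩ := cauchySeq_tendsto_of_complete hcs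
    exact ⟨g, fun _ => (tendsto_add_atTop_iff_nat
      (f := fun L => iteratedDerivWithin k (νL L) I x) 1).1 hg⟩
  choose g hg using hex
  have hrate : ∀ k : ℕ, ∀ α' ∈ Set.Ioo (0 : ℝ) α, ∀ K : Set ℝ, K ⊆ I → IsCompact K →
        ∃ C' : ℝ, ∀ L : ℕ, 1 ≤ L → ∀ ρ ∈ K,
          |iteratedDerivWithin k (νL L) I ρ - g k ρ| ≤ C' * (L : ℝ) ^ (-α') := by
    intro k α' hα' K hK hc
    obtain ⟨C, hC, hb⟩ := hF k α' hα'.1 hα'.2 K hK hc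
    refine ⟨C, fun L hL x hx => ?_⟩
    refine le_of_tendsto ((hg k x (hK hx)).const_sub _).abs ?_
    filter_upwards [eventually_ge_atTop L] with L' hL'
    exact hb ⟨(L, L'), hL, hL'⟩ x hx
  have hunif : ∀ k : ℕ, TendstoLocallyUniformlyOn
      (fun L => iteratedDerivWithin k (νL L) I) (g k) atTop I := by
    intro k
    rw [tendstoLocallyUniformlyOn_iff_forall_isCompact hIopen]
    intro K hK hc
    obtain ⟨C, hC⟩ := hrate k (α / 2) ⟨by linarith, by linarith⟩ K hK hc
    rw [Metric.tendstoUniformlyOn_iff]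
    intro ε hε
    filter_upwards [(hlim0 C (α / 2) (by linarith)).eventually_lt_const hε,
      eventually_ge_atTop 1] with L h1 h2 x hx
    rw [dist_comm, Real.dist_eq]
    exact (hC L h2 x hx).trans_lt h1
  have hgd : ∀ k : ℕ, ∀ x ∈ I, HasDerivAt (g k) (g (k + 1) x) x := by
    intro k x hx
    exact hasDerivAt_of_tendstoLocallyUniformlyOn hIopen (hunif (k + 1))
      (Eventually.of_forall fun L y hy => hder k L y hy) (fun y hy => hg k y hy) hx
  have hg0 : ∀ x ∈ I, ν x = g 0 x := by
    intro x hx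
    obtain ⟨C, hC⟩ := h1plus {x} (by simpa using hx) isCompact_singleton
    have t1 : Tendsto (fun L => νL L x) atTop (nhds (g 0 x)) := by simpa using hg 0 x hx
    refine tendsto_nhds_unique ?_ t1
    rw [tendsto_iff_dist_tendsto_zero]
    refine squeeze_zero' (Eventually.of_forall fun _ => dist_nonneg) ?_ (hlim0 C α hα)
    filter_upwards [eventually_ge_atTop 1] with L hL
    rw [Real.dist_eq]
    exact hC L hL x rfl
  have hgν : ∀ k : ℕ, ∀ x ∈ I, iteratedDerivWithin k ν I x = g k x := by
    intro k
    induction k with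
    | zero => intro x hx; simpa using hg0 x hx
    | succ k ih =>
      intro x hx
      rw [iteratedDerivWithin_succ, derivWithin_congr (fun y hy => ih y hy) (ih x hx)]
      exact (hgd k x hx).hasDerivWithinAt.derivWithin (hU x hx)
  refine ⟨?_, ?_⟩
  · refine contDiffOn_of_differentiableOn_deriv fun m _ => ?_
    intro x hx
    exact ((hgd m x hx).differentiableAt.differentiableWithinAt).congr
      (fun y hy => hgν m y hy) (hgν m x hx)
  · intro k α' hα' K hK hc
    obtain ⟨C, hC⟩ := hrate k α' hα' K hK hc
    refine ⟨C, fun L hL x hx => ?_⟩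
    rw [hgν k x (hK hx)]
    exact hC L hL x hx
end
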